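/- For the Maxwell Lagrangian density L = −(1/16π)√|det g| F_{μν}F^{μν} with F = dA, the divergence of the canonical Noether current H^μ_c[X] = π^{βμ} L_X A_β − X^μ L for an arbitrary vector field X equals −(√|det g|/4π)[ −4π j^ν L_X A_ν + F^{μν} Δ_{νμ}(X,A) + F_μ{}^β F_{νβ}(∇^{(μ}X^{ν)} − (1/4)g^{μν}∇_α X^α) ], where j^μ := (1/4π)∇_ν F^{μν} and Δ_{νμ}(X,A) := [∇_μ, L_X]A_ν. -/

import Mathlib

/-!
Statement 4: For the Maxwell Lagrangian density L = −(1/16π)√|det g| F_{μν}F^{μν},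
the divergence of the canonical Noether current H^μ_c[X] = π^{βμ} L_X A_β − X^μ L,
for an arbitrary vector field X, equals
 −(√|det g|/4π)[ −4π j^ν L_X A_ν + F^{μν} Δ_{νμ}(X,A)
      + F_μ{}^β F_{νβ}(∇^{(μ}X^{ν)} − (1/4) g^{μν} ∇_α X^α) ],
where j^μ := (1/4π)∇_ν F^{μν} and Δ_{νμ}(X,A) := [∇_μ, L_X]A_ν.
Formulated in local coordinates, Γ being the Levi-Civita connection of g.
-/

noncomputable section

abbrev Pt4 := Fin 4 → ℝ

def pd (i : Fin 4) (f : Pt4 → ℝ) (x : Pt4) : ℝ := fderiv ℝ f x (Pi.single i 1)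

def covOne (Γ : Fin 4 → Fin 4 → Fin 4 → Pt4 → ℝ) (A : Fin 4 → Pt4 → ℝ)
    (δ β : Fin 4) (x : Pt4) : ℝ :=
  pd δ (A β) x - ∑ γ, Γ γ δ β x * A γ x

def covVec (Γ : Fin 4 → Fin 4 → Fin 4 → Pt4 → ℝ) (V : Fin 4 → Pt4 → ℝ)
    (δ μ : Fin 4) (x : Pt4) : ℝ :=
  pd δ (V μ) x + ∑ l, Γ μ δ l x * V l x

def lieOne (V A : Fin 4 → Pt4 → ℝ) (β : Fin 4) (x : Pt4) : ℝ :=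
  ∑ γ, V γ x * pd γ (A β) x + ∑ γ, A γ x * pd β (V γ) x

def lieT2 (V : Fin 4 → Pt4 → ℝ) (T : Fin 4 → Fin 4 → Pt4 → ℝ)
    (β δ : Fin 4) (x : Pt4) : ℝ :=
  ∑ γ, V γ x * pd γ (fun y => T β δ y) x
    + ∑ γ, T γ δ x * pd β (V γ) x
    + ∑ γ, T β γ x * pd δ (V γ) x

/-- Δ_{νμ}(X,A) := [∇_μ, L_X]A_ν. -/
def Delta (Γ : Fin 4 → Fin 4 → Fin 4 → Pt4 → ℝ) (X A : Fin 4 → Pt4 → ℝ)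
    (ν μ : Fin 4) (x : Pt4) : ℝ :=
  covOne Γ (fun β' y => lieOne X A β' y) μ ν x
    - lieT2 X (fun μ' ν' => covOne Γ A μ' ν') μ ν x

def volg (g : Fin 4 → Fin 4 → Pt4 → ℝ) (x : Pt4) : ℝ :=
  Real.sqrt |(Matrix.of fun i j : Fin 4 => g i j x).det|

def FlowF (A : Fin 4 → Pt4 → ℝ) (a b : Fin 4) (x : Pt4) : ℝ :=
  pd a (A b) x - pd b (A a) x

def Fup (gi : Fin 4 → Fin 4 → Pt4 → ℝ) (A : Fin 4 → Pt4 → ℝ)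
    (a b : Fin 4) (x : Pt4) : ℝ :=
  ∑ α, ∑ β, gi a α x * gi b β x * FlowF A α β x

/-- F_μ{}^β = F_{μγ} g^{γβ}. -/
def Fmix (gi : Fin 4 → Fin 4 → Pt4 → ℝ) (A : Fin 4 → Pt4 → ℝ)
    (μ β : Fin 4) (x : Pt4) : ℝ :=
  ∑ γ, FlowF A μ γ x * gi γ β x

/-- j^μ := (1/4π) ∇_ν F^{μν}. -/
def jcur (gi : Fin 4 → Fin 4 → Pt4 → ℝ) (Γ : Fin 4 → Fin 4 → Fin 4 → Pt4 → ℝ)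
    (A : Fin 4 → Pt4 → ℝ) (μ : Fin 4) (x : Pt4) : ℝ :=
  (1/(4*Real.pi)) * ∑ ν, (pd ν (fun y => Fup gi A μ ν y) x
    + ∑ l, Γ μ ν l x * Fup gi A l ν x
    + ∑ l, Γ ν ν l x * Fup gi A μ l x)

/-- The canonical Noether current H^μ_c[X] = π^{βμ} L_X A_β − X^μ L of the Maxwell field. -/
def noether (g gi : Fin 4 → Fin 4 → Pt4 → ℝ) (A X : Fin 4 → Pt4 → ℝ)
    (μ : Fin 4) (x : Pt4) : ℝ :=
  -(1/(4*Real.pi)) * volg g x *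
    ((∑ β, Fup gi A μ β x * lieOne X A β x)
      - (1/4) * (∑ α, ∑ β, Fup gi A α β x * FlowF A α β x) * X μ x)

lemma pd_add {i : Fin 4} {f h : Pt4 → ℝ} {x : Pt4} (hf : DifferentiableAt ℝ f x)
    (hh : DifferentiableAt ℝ h x) : pd i (fun y => f y + h y) x = pd i f x + pd i h x := by
  simp [pd, fderiv_fun_add hf hh]

lemma pd_sub {i : Fin 4} {f h : Pt4 → ℝ} {x : Pt4} (hf : DifferentiableAt ℝ f x)
    (hh : DifferentiableAt ℝ h x) : pd i (fun y => f y - h y) x = pd i f x - pd i h x := by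
  simp [pd, fderiv_fun_sub hf hh]

lemma pd_mul {i : Fin 4} {f h : Pt4 → ℝ} {x : Pt4} (hf : DifferentiableAt ℝ f x)
    (hh : DifferentiableAt ℝ h x) :
    pd i (fun y => f y * h y) x = pd i f x * h x + f x * pd i h x := by
  simp [pd, fderiv_fun_mul hf hh]
  ring

lemma pd_const_mul {i : Fin 4} {f : Pt4 → ℝ} {x : Pt4} (c : ℝ) (hf : DifferentiableAt ℝ f x) :
    pd i (fun y => c * f y) x = c * pd i f x := by
  simp [pd, fderiv_const_mul hf]

lemma pd_const (i : Fin 4) (c : ℝ) (x : Pt4) : pd i (fun _ => c) x = 0 := by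
  simp [pd]

lemma pd_sum {ι : Type*} {i : Fin 4} {s : Finset ι} {f : ι → Pt4 → ℝ} {x : Pt4}
    (hf : ∀ j ∈ s, DifferentiableAt ℝ (f j) x) :
    pd i (fun y => ∑ j ∈ s, f j y) x = ∑ j ∈ s, pd i (f j) x := by
  simp [pd, fderiv_fun_sum hf]

lemma ContDiff.pd {f : Pt4 → ℝ} (hf : ContDiff ℝ (⊤ : ℕ∞) f) (i : Fin 4) :
    ContDiff ℝ (⊤ : ℕ∞) (pd i f) :=
  (hf.fderiv_right (m := (⊤ : ℕ∞)) le_rfl).clm_apply contDiff_const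

lemma ContDiff.differentiableAt_pt {f : Pt4 → ℝ} (hf : ContDiff ℝ (⊤ : ℕ∞) f) (x : Pt4) :
    DifferentiableAt ℝ f x :=
  hf.contDiffAt.differentiableAt (by simp)

/-- The Jacobi formula for the derivative of a determinant. -/
lemma hasFDerivAt_det {E n : Type*} [NormedAddCommGroup E] [NormedSpace ℝ E] [Fintype n]
    [DecidableEq n] {M : n → n → E → ℝ} {M' : n → n → E →L[ℝ] ℝ} {x : E}
    (hM : ∀ i j, HasFDerivAt (M i j) (M' i j) x) :
    HasFDerivAt (fun y => (Matrix.of fun i j => M i j y).det)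
      (∑ i, ∑ j, (Matrix.of fun i j => M i j x).adjugate i j • M' j i) x := by
  simp only [Matrix.det_apply']
  have h := HasFDerivAt.fun_sum (u := (Finset.univ : Finset (Equiv.Perm n))) fun σ _ =>
    (HasFDerivAt.finsetProd (u := Finset.univ) fun i _ => hM (σ i) i).const_mul
      ((Equiv.Perm.sign σ : ℤ) : ℝ)
  convert! h using 1
  ext v
  have key : ∀ i, ∑ j, (Matrix.of fun i j => M i j x).adjugate i j * M' j i v
      = ((Matrix.of fun i j => M i j x).updateCol i fun j => M' j i v).det := by
    intro i
    rw [← Matrix.cramer_apply, Matrix.cramer_eq_adjugate_mulVec]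
    rfl
  simp only [FunLike.coe_sum, FunLike.coe_smul, Finset.sum_apply, Pi.smul_apply, smul_eq_mul, key]
  simp only [Matrix.det_apply', Finset.mul_sum]
  rw [Finset.sum_comm]
  refine Finset.sum_congr rfl fun σ _ => Finset.sum_congr rfl fun i _ => ?_
  rw [← Finset.prod_erase_mul _ _ (Finset.mem_univ i)]
  congr 2
  · refine Finset.prod_congr rfl fun j hj => ?_
    simp [Matrix.updateCol_ne (Finset.ne_of_mem_erase hj)]
  · simp

lemma sum_sum_mul_eq_zero_of_antisymm_symm {ι : Type*} [Fintype ι] {P Q : ι → ι → ℝ}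
    (hP : ∀ a b, P a b = -P b a) (hQ : ∀ a b, Q a b = Q b a) :
    ∑ a, ∑ b, P a b * Q a b = 0 := by
  have h : ∑ a, ∑ b, P a b * Q a b = -∑ a, ∑ b, P a b * Q a b := by
    conv_lhs => rw [Finset.sum_comm]
    simp only [← Finset.sum_neg_distrib]
    refine Finset.sum_congr rfl fun a _ => Finset.sum_congr rfl fun b _ => ?_
    rw [hP b a, hQ b a]
    ring
  linarith

/-- An antisymmetric tensor only sees the antisymmetric part of what it is contracted with. -/
lemma sum_sum_mul_of_antisymm {ι : Type*} [Fintype ι] {P : ι → ι → ℝ} (hP : ∀ a b, P a b = -P b a)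
    (Q : ι → ι → ℝ) :
    ∑ a, ∑ b, P a b * Q a b = (1 / 2) * ∑ a, ∑ b, P a b * (Q a b - Q b a) := by
  have h := sum_sum_mul_eq_zero_of_antisymm_symm hP (Q := fun a b => Q a b + Q b a)
    fun a b => add_comm _ _
  simp only [mul_add, Finset.sum_add_distrib, mul_sub, Finset.sum_sub_distrib] at h ⊢
  linarith

lemma sum_comm_pairs {ι : Type*} [Fintype ι] (f : ι → ι → ι → ι → ℝ) :
    ∑ a, ∑ b, ∑ c, ∑ d, f a b c d = ∑ c, ∑ d, ∑ a, ∑ b, f a b c d :=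
  calc _ = ∑ a, ∑ c, ∑ d, ∑ b, f a b c d :=
        Finset.sum_congr rfl fun _ _ => Finset.sum_comm.trans <|
          Finset.sum_congr rfl fun _ _ => Finset.sum_comm
    _ = _ := Finset.sum_comm.trans <| Finset.sum_congr rfl fun _ _ => Finset.sum_comm

lemma volg_pos {g : Fin 4 → Fin 4 → Pt4 → ℝ} {x : Pt4}
    (hdet : (Matrix.of fun i j : Fin 4 => g i j x).det ≠ 0) : 0 < volg g x :=
  Real.sqrt_pos.2 (abs_pos.2 hdet)

lemma hasFDerivAt_volg {g gi : Fin 4 → Fin 4 → Pt4 → ℝ} {x : Pt4}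
    (hg : ∀ μ ν, DifferentiableAt ℝ (g μ ν) x)
    (hdet : (Matrix.of fun i j : Fin 4 => g i j x).det ≠ 0)
    (hinv : ∀ μ ν, (∑ σ, gi μ σ x * g σ ν x) = if μ = ν then (1:ℝ) else 0) :
    HasFDerivAt (volg g)
      ((volg g x / 2) • ∑ i, ∑ j, gi i j x • fderiv ℝ (g j i) x) x := by
  have hd := hasFDerivAt_det fun i j => (hg i j).hasFDerivAt
  have hv := ((hd.abs hdet).sqrt (abs_ne_zero.2 hdet))
  have hpos := volg_pos hdet
  have hinv' : (Matrix.of fun i j => gi i j x) * (Matrix.of fun i j => g i j x) = 1 := by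
    ext i j
    simp [Matrix.mul_apply, hinv, Matrix.one_apply]
  have hadj : (Matrix.of fun i j => g i j x).adjugate
      = (Matrix.of fun i j => g i j x).det • (Matrix.of fun i j => gi i j x) := by
    have := congrArg (fun N => (Matrix.of fun i j => gi i j x) * N)
      (Matrix.mul_adjugate (Matrix.of fun i j => g i j x))
    simpa [← mul_assoc, hinv'] using this
  refine hv.congr_fderiv ?_
  have hsq : volg g x * volg g x = |(Matrix.of fun i j : Fin 4 => g i j x).det| :=
    Real.mul_self_sqrt (abs_nonneg _)
  rw [hadj]
  simp only [Matrix.smul_apply, smul_eq_mul, mul_smul, ← Finset.smul_sum, Matrix.of_apply]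
  rw [smul_smul, smul_smul]
  congr 1
  change 1 / (2 * volg g x) * _ * _ = _
  rw [mul_assoc, sign_mul_self, ← hsq]
  field_simp

section LeviCivita

variable {g gi : Fin 4 → Fin 4 → Pt4 → ℝ} {Γ : Fin 4 → Fin 4 → Fin 4 → Pt4 → ℝ}

lemma inverse_metric_symm {x : Pt4} (hgsym : ∀ μ ν, g μ ν x = g ν μ x)
    (hinv : ∀ μ ν, (∑ σ, gi μ σ x * g σ ν x) = if μ = ν then (1:ℝ) else 0) (a b : Fin 4) :
    gi a b x = gi b a x := by
  set G := Matrix.of fun i j => g i j x with hG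
  set H := Matrix.of fun i j => gi i j x with hH
  have h1 : H * G = 1 := by
    ext i j
    simp [hG, hH, Matrix.mul_apply, hinv, Matrix.one_apply]
  have hGt : G.transpose = G := by
    ext i j
    simp [hG, hgsym j i]
  have h2 : G * H.transpose = 1 := by
    have := congrArg Matrix.transpose h1
    rwa [Matrix.transpose_mul, hGt, Matrix.transpose_one] at this
  have h3 : H = H.transpose := left_inv_eq_right_inv h1 h2
  simpa [hH] using congrFun (congrFun h3 a) b

lemma christoffel_symm {x : Pt4} (hgsym : ∀ μ ν x, g μ ν x = g ν μ x)
    (hΓ : ∀ l μ ν x, Γ l μ ν x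
      = (1/2) * ∑ σ, gi l σ x * (pd μ (g σ ν) x + pd ν (g σ μ) x - pd σ (g μ ν) x))
    (l μ ν : Fin 4) : Γ l μ ν x = Γ l ν μ x := by
  have : g μ ν = g ν μ := funext (hgsym μ ν)
  rw [hΓ, hΓ, this]
  congr 1
  refine Finset.sum_congr rfl fun σ _ => by ring

lemma sum_christoffel_contract {x : Pt4} (hgisym : ∀ μ ν, gi μ ν x = gi ν μ x)
    (hΓ : ∀ l μ ν x, Γ l μ ν x
      = (1/2) * ∑ σ, gi l σ x * (pd μ (g σ ν) x + pd ν (g σ μ) x - pd σ (g μ ν) x))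
    (μ : Fin 4) :
    ∑ a, Γ a a μ x = (1/2) * ∑ a, ∑ b, gi a b x * pd μ (g b a) x := by
  have h : ∑ a, ∑ b, (pd a (g b μ) x - pd b (g a μ) x) * gi a b x = 0 :=
    sum_sum_mul_eq_zero_of_antisymm_symm (fun a b => by ring) hgisym
  simp only [hΓ, ← Finset.mul_sum]
  congr 1
  rw [← add_zero (∑ a, ∑ b, gi a b x * pd μ (g b a) x), ← h]
  simp only [← Finset.sum_add_distrib]
  refine Finset.sum_congr rfl fun a _ => Finset.sum_congr rfl fun b _ => by ring

lemma pd_volg {x : Pt4} (hg : ∀ μ ν, DifferentiableAt ℝ (g μ ν) x)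
    (hgsym : ∀ μ ν x, g μ ν x = g ν μ x)
    (hdet : (Matrix.of fun i j : Fin 4 => g i j x).det ≠ 0)
    (hinv : ∀ μ ν, (∑ σ, gi μ σ x * g σ ν x) = if μ = ν then (1:ℝ) else 0)
    (hΓ : ∀ l μ ν x, Γ l μ ν x
      = (1/2) * ∑ σ, gi l σ x * (pd μ (g σ ν) x + pd ν (g σ μ) x - pd σ (g μ ν) x))
    (μ : Fin 4) : pd μ (volg g) x = volg g x * ∑ a, Γ a a μ x := by
  rw [sum_christoffel_contract
    (inverse_metric_symm (fun a b => hgsym a b x) hinv) hΓ]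
  rw [pd, (hasFDerivAt_volg hg hdet hinv).fderiv]
  simp [pd]
  ring

/-- The Levi-Civita connection annihilates the inverse metric. -/
lemma pd_inverse_metric {x : Pt4} (hg : ∀ μ ν, DifferentiableAt ℝ (g μ ν) x)
    (hgi : ∀ μ ν, DifferentiableAt ℝ (gi μ ν) x)
    (hgsym : ∀ μ ν x, g μ ν x = g ν μ x)
    (hinv : ∀ μ ν x, (∑ σ, gi μ σ x * g σ ν x) = if μ = ν then (1:ℝ) else 0)
    (hΓ : ∀ l μ ν x, Γ l μ ν x
      = (1/2) * ∑ σ, gi l σ x * (pd μ (g σ ν) x + pd ν (g σ μ) x - pd σ (g μ ν) x))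
    (c a b : Fin 4) :
    pd c (gi a b) x = -∑ d, (Γ a c d x * gi d b x + Γ b c d x * gi d a x) := by
  have hgisym := inverse_metric_symm (fun a b => hgsym a b x) (fun a b => hinv a b x)
  have hs : ∀ a b, g a b = g b a := fun a b => funext (hgsym a b)
  set G := Matrix.of fun i j => g i j x with hG
  set H := Matrix.of fun i j => gi i j x with hH
  set dG := Matrix.of fun i j => pd c (g i j) x with hdG
  set dH := Matrix.of fun i j => pd c (gi i j) x with hdH
  have h1 : H * G = 1 := by
    ext i j
    simp [hG, hH, Matrix.mul_apply, hinv, Matrix.one_apply]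
  have h2 : G * H = 1 := mul_eq_one_comm.1 h1
  have h3 : dH * G + H * dG = 0 := by
    ext i j
    have h : pd c (fun y => ∑ σ, gi i σ y * g σ j y) x = 0 := by
      simp only [hinv, pd_const]
    rw [pd_sum fun σ _ => (hgi i σ).fun_mul (hg σ j)] at h
    simp only [pd_mul (hgi i _) (hg _ j), Finset.sum_add_distrib] at h
    simpa [Matrix.mul_apply, hG, hH, hdG, hdH] using h
  have h4 : dH = -(H * dG * H) := by
    have := congrArg (· * H) h3
    simp only [add_mul, mul_assoc, h2, zero_mul, mul_one] at this
    rw [mul_assoc]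
    exact eq_neg_of_add_eq_zero_left this
  have h5 : pd c (gi a b) x = -∑ d, ∑ e, gi a e x * pd c (g e d) x * gi d b x := by
    have := congrFun (congrFun h4 a) b
    simpa [Matrix.mul_apply, hG, hH, hdG, hdH, Finset.sum_mul] using this
  rw [h5, neg_inj]
  have hP : ∑ d, Γ a c d x * gi d b x = ∑ d, ∑ e, (1/2) * (gi a e x * gi d b x *
      (pd c (g e d) x + pd d (g e c) x - pd e (g c d) x)) := by
    simp only [hΓ, Finset.mul_sum, Finset.sum_mul]
    exact Finset.sum_congr rfl fun d _ => Finset.sum_congr rfl fun e _ => by ring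
  have hQ : ∑ d, Γ b c d x * gi d a x = ∑ d, ∑ e, (1/2) * (gi a e x * gi d b x *
      (pd c (g e d) x - pd d (g e c) x + pd e (g c d) x)) := by
    simp only [hΓ, Finset.mul_sum, Finset.sum_mul]
    rw [Finset.sum_comm]
    refine Finset.sum_congr rfl fun d _ => Finset.sum_congr rfl fun e _ => ?_
    rw [hgisym b d, hgisym e a, hs d e, hs d c, hs c e]
    ring
  rw [Finset.sum_add_distrib, hP, hQ]
  simp only [← Finset.sum_add_distrib]
  exact Finset.sum_congr rfl fun d _ => Finset.sum_congr rfl fun e _ => by ring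

end LeviCivita

section FieldStrength

variable {gi : Fin 4 → Fin 4 → Pt4 → ℝ} {A X : Fin 4 → Pt4 → ℝ}

lemma FlowF_antisymm (A : Fin 4 → Pt4 → ℝ) (a b : Fin 4) (x : Pt4) :
    FlowF A a b x = -FlowF A b a x := by
  simp [FlowF]

lemma Fup_antisymm (gi : Fin 4 → Fin 4 → Pt4 → ℝ) (A : Fin 4 → Pt4 → ℝ) (a b : Fin 4) (x : Pt4) :
    Fup gi A a b x = -Fup gi A b a x := by
  unfold Fup
  rw [Finset.sum_comm]
  simp only [← Finset.sum_neg_distrib]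
  refine Finset.sum_congr rfl fun α _ => Finset.sum_congr rfl fun β _ => ?_
  rw [FlowF_antisymm A β α]
  ring

lemma contDiff_FlowF (hA : ∀ μ, ContDiff ℝ (⊤ : ℕ∞) (A μ)) (a b : Fin 4) :
    ContDiff ℝ (⊤ : ℕ∞) (FlowF A a b) :=
  ((hA b).pd a).sub ((hA a).pd b)

lemma contDiff_Fup (hgi : ∀ μ ν, ContDiff ℝ (⊤ : ℕ∞) (gi μ ν))
    (hA : ∀ μ, ContDiff ℝ (⊤ : ℕ∞) (A μ)) (a b : Fin 4) :
    ContDiff ℝ (⊤ : ℕ∞) (Fup gi A a b) :=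
  ContDiff.sum fun α _ => ContDiff.sum fun β _ =>
    ((hgi a α).mul (hgi b β)).mul (contDiff_FlowF hA α β)

lemma contDiff_lieOne (hX : ∀ μ, ContDiff ℝ (⊤ : ℕ∞) (X μ))
    (hA : ∀ μ, ContDiff ℝ (⊤ : ℕ∞) (A μ)) (b : Fin 4) :
    ContDiff ℝ (⊤ : ℕ∞) (lieOne X A b) :=
  (ContDiff.sum fun γ _ => (hX γ).mul ((hA b).pd γ)).add
    (ContDiff.sum fun γ _ => (hA γ).mul ((hX γ).pd b))

lemma pd_Fup (hgi : ∀ μ ν, ContDiff ℝ (⊤ : ℕ∞) (gi μ ν))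
    (hA : ∀ μ, ContDiff ℝ (⊤ : ℕ∞) (A μ)) (c a b : Fin 4) (x : Pt4) :
    pd c (Fup gi A a b) x = ∑ α, ∑ β, (pd c (gi a α) x * gi b β x * FlowF A α β x
      + gi a α x * pd c (gi b β) x * FlowF A α β x
      + gi a α x * gi b β x * pd c (FlowF A α β) x) := by
  have dg := fun a b => (hgi a b).differentiableAt_pt x
  have dF := fun a b => (contDiff_FlowF hA a b).differentiableAt_pt x
  change pd c (fun y => ∑ α, ∑ β, gi a α y * gi b β y * FlowF A α β y) x = _
  rw [pd_sum fun α _ => DifferentiableAt.fun_sum fun β _ =>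
    ((dg a α).fun_mul (dg b β)).fun_mul (dF α β)]
  refine Finset.sum_congr rfl fun α _ => ?_
  rw [pd_sum fun β _ => ((dg a α).fun_mul (dg b β)).fun_mul (dF α β)]
  refine Finset.sum_congr rfl fun β _ => ?_
  rw [pd_mul ((dg a α).fun_mul (dg b β)) (dF α β), pd_mul (dg a α) (dg b β)]
  ring

lemma Fup_eq_sum_Fmix {x : Pt4} (hgisym : ∀ μ ν, gi μ ν x = gi ν μ x) (a b : Fin 4) :
    Fup gi A a b x = ∑ m, gi a m x * Fmix gi A m b x := by
  simp only [Fup, Fmix, Finset.mul_sum]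
  refine Finset.sum_congr rfl fun α _ => Finset.sum_congr rfl fun β _ => ?_
  rw [hgisym b β]
  ring

lemma sum_Fmix_mul_FlowF_symm {x : Pt4} (hgisym : ∀ μ ν, gi μ ν x = gi ν μ x) (a b : Fin 4) :
    ∑ β, Fmix gi A a β x * FlowF A b β x = ∑ β, Fmix gi A b β x * FlowF A a β x := by
  simp only [Fmix, Finset.sum_mul]
  rw [Finset.sum_comm]
  refine Finset.sum_congr rfl fun α _ => Finset.sum_congr rfl fun β _ => ?_
  rw [hgisym α β]
  ring

lemma sum_Fup_mul_sum_FlowF {x : Pt4} (hgisym : ∀ μ ν, gi μ ν x = gi ν μ x)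
    (P : Fin 4 → Fin 4 → ℝ) :
    ∑ a, ∑ b, Fup gi A a b x * ∑ c, FlowF A c b x * P a c
      = ∑ m, ∑ c, (∑ b, Fmix gi A m b x * FlowF A c b x) * ∑ a, gi m a x * P a c := by
  have hL : ∑ a, ∑ b, Fup gi A a b x * ∑ c, FlowF A c b x * P a c
      = ∑ a, ∑ c, ∑ m, ∑ b, gi a m x * Fmix gi A m b x * (FlowF A c b x * P a c) := by
    refine Finset.sum_congr rfl fun a _ => ?_
    simp only [Fup_eq_sum_Fmix hgisym, Finset.mul_sum, Finset.sum_mul]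
    rw [Finset.sum_comm]
    exact Finset.sum_congr rfl fun c _ => Finset.sum_comm
  have hR : ∑ m, ∑ c, (∑ b, Fmix gi A m b x * FlowF A c b x) * ∑ a, gi m a x * P a c
      = ∑ m, ∑ c, ∑ a, ∑ b, gi a m x * Fmix gi A m b x * (FlowF A c b x * P a c) := by
    refine Finset.sum_congr rfl fun m _ => Finset.sum_congr rfl fun c _ => ?_
    simp only [Finset.mul_sum, Finset.sum_mul]
    refine Finset.sum_congr rfl fun a _ => Finset.sum_congr rfl fun b _ => ?_
    rw [hgisym m a]
    ring
  rw [hL, hR]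
  calc _ = ∑ c, ∑ a, ∑ m, ∑ b, gi a m x * Fmix gi A m b x * (FlowF A c b x * P a c) :=
        Finset.sum_comm
    _ = ∑ c, ∑ m, ∑ a, ∑ b, gi a m x * Fmix gi A m b x * (FlowF A c b x * P a c) :=
        Finset.sum_congr rfl fun c _ => Finset.sum_comm
    _ = _ := Finset.sum_comm

lemma sum_Fup_mul_sum_FlowF_right (x : Pt4) (P : Fin 4 → Fin 4 → ℝ) :
    ∑ a, ∑ b, Fup gi A a b x * ∑ c, FlowF A a c x * P b c
      = ∑ a, ∑ b, Fup gi A a b x * ∑ c, FlowF A c b x * P a c := by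
  rw [Finset.sum_comm]
  refine Finset.sum_congr rfl fun a _ => Finset.sum_congr rfl fun b _ => ?_
  rw [Fup_antisymm, neg_mul, ← mul_neg, ← Finset.sum_neg_distrib]
  congr 1
  refine Finset.sum_congr rfl fun c _ => ?_
  rw [FlowF_antisymm]
  ring

lemma sum_Fup_mul_FlowF {x : Pt4} (hgisym : ∀ μ ν, gi μ ν x = gi ν μ x) :
    ∑ a, ∑ b, Fup gi A a b x * FlowF A a b x
      = ∑ m, ∑ c, (∑ b, Fmix gi A m b x * FlowF A c b x) * gi m c x := by
  have h := sum_Fup_mul_sum_FlowF (A := A) hgisym fun a c => if a = c then 1 else 0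
  simpa using h

lemma pd_sum_Fup_mul_FlowF (hgi : ∀ μ ν, ContDiff ℝ (⊤ : ℕ∞) (gi μ ν))
    (hA : ∀ μ, ContDiff ℝ (⊤ : ℕ∞) (A μ)) {x : Pt4} (hgisym : ∀ μ ν, gi μ ν x = gi ν μ x)
    (c : Fin 4) :
    pd c (fun y => ∑ a, ∑ b, Fup gi A a b y * FlowF A a b y) x
      = 2 * (∑ a, ∑ b, Fup gi A a b x * pd c (FlowF A a b) x)
        + 2 * ∑ a, ∑ α, pd c (gi a α) x * ∑ β, Fmix gi A a β x * FlowF A α β x := by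
  have dU := fun a b => (contDiff_Fup hgi hA a b).differentiableAt_pt x
  have dF := fun a b => (contDiff_FlowF hA a b).differentiableAt_pt x
  rw [pd_sum fun a _ => DifferentiableAt.fun_sum fun b _ => (dU a b).fun_mul (dF a b)]
  simp only [pd_sum fun b _ => (dU _ b).fun_mul (dF _ b), pd_mul (dU _ _) (dF _ _),
    Finset.sum_add_distrib]
  have h1 : ∑ a, ∑ b, (∑ α, ∑ β, pd c (gi a α) x * gi b β x * FlowF A α β x) * FlowF A a b x
      = ∑ a, ∑ α, pd c (gi a α) x * ∑ β, Fmix gi A a β x * FlowF A α β x := by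
    refine Finset.sum_congr rfl fun a _ => ?_
    simp only [Fmix, Finset.mul_sum, Finset.sum_mul]
    rw [Finset.sum_comm]
    refine Finset.sum_congr rfl fun α _ => ?_
    rw [Finset.sum_comm]
    exact Finset.sum_congr rfl fun β _ => Finset.sum_congr rfl fun b _ => by ring
  have h2 : ∑ a, ∑ b, (∑ α, ∑ β, gi a α x * pd c (gi b β) x * FlowF A α β x) * FlowF A a b x
      = ∑ a, ∑ b, (∑ α, ∑ β, pd c (gi a α) x * gi b β x * FlowF A α β x) * FlowF A a b x := by
    rw [Finset.sum_comm]
    refine Finset.sum_congr rfl fun a _ => Finset.sum_congr rfl fun b _ => ?_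
    rw [FlowF_antisymm A b a, Finset.sum_comm, mul_neg, ← neg_mul]
    simp only [← Finset.sum_neg_distrib]
    congr 1
    refine Finset.sum_congr rfl fun α _ => Finset.sum_congr rfl fun β _ => ?_
    rw [FlowF_antisymm A β α]
    ring
  have h3 : ∑ a, ∑ b, (∑ α, ∑ β, gi a α x * gi b β x * pd c (FlowF A α β) x) * FlowF A a b x
      = ∑ a, ∑ b, Fup gi A a b x * pd c (FlowF A a b) x := by
    simp only [Fup, Finset.sum_mul]
    rw [sum_comm_pairs]
    refine Finset.sum_congr rfl fun α _ => Finset.sum_congr rfl fun β _ =>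
      Finset.sum_congr rfl fun a _ => Finset.sum_congr rfl fun b _ => ?_
    rw [hgisym a α, hgisym b β]
    ring
  simp only [pd_Fup hgi hA, Finset.sum_add_distrib, add_mul, h1, h2, h3]
  ring

lemma lieT2_sub_swap {T F : Fin 4 → Fin 4 → Pt4 → ℝ} {x : Pt4}
    (hT : ∀ a b, DifferentiableAt ℝ (T a b) x) (hF : ∀ a b y, T a b y - T b a y = F a b y)
    (a b : Fin 4) : lieT2 X T a b x - lieT2 X T b a x = lieT2 X F a b x := by
  have h : ∀ γ, pd γ (F a b) x = pd γ (T a b) x - pd γ (T b a) x := fun γ => by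
    rw [← pd_sub (hT a b) (hT b a)]
    exact congrArg (pd γ · x) (funext fun y => (hF a b y).symm)
  simp only [lieT2, h, mul_sub, Finset.sum_sub_distrib]
  simp only [← hF, sub_mul, Finset.sum_sub_distrib]
  ring

end FieldStrength

section Divergence

variable {g gi : Fin 4 → Fin 4 → Pt4 → ℝ} {Γ : Fin 4 → Fin 4 → Fin 4 → Pt4 → ℝ}
  {A X : Fin 4 → Pt4 → ℝ}

lemma sum_Fup_mul_Delta {x : Pt4} (hΓdiff : ∀ l μ ν, ContDiff ℝ (⊤ : ℕ∞) (Γ l μ ν))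
    (hΓsym : ∀ l μ ν y, Γ l μ ν y = Γ l ν μ y) (hA : ∀ μ, ContDiff ℝ (⊤ : ℕ∞) (A μ)) :
    ∑ μ, ∑ ν, Fup gi A μ ν x * Delta Γ X A ν μ x
      = ∑ μ, ∑ ν, Fup gi A μ ν x * pd μ (lieOne X A ν) x
        - (1 / 2) * ∑ μ, ∑ ν, Fup gi A μ ν x * lieT2 X (FlowF A) μ ν x := by
  have hcov : ∀ a b, DifferentiableAt ℝ (covOne Γ A a b) x := fun a b =>
    (((hA b).pd a).sub
      (ContDiff.sum fun γ _ => (hΓdiff γ a b).mul (hA γ))).differentiableAt_pt x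
  have hanti : ∀ a b y, covOne Γ A a b y - covOne Γ A b a y = FlowF A a b y := fun a b y => by
    simp [covOne, FlowF, hΓsym _ a b y]
  have h1 := sum_sum_mul_of_antisymm (fun a b => Fup_antisymm gi A a b x)
    fun μ ν => lieT2 X (covOne Γ A) μ ν x
  have h2 := sum_sum_mul_eq_zero_of_antisymm_symm (fun a b => Fup_antisymm gi A a b x)
    (Q := fun μ ν => ∑ γ, Γ γ μ ν x * lieOne X A γ x) fun μ ν => by
      simp only [hΓsym _ μ ν x]
  simp only [lieT2_sub_swap hcov hanti] at h1
  have h3 : ∀ μ ν, Delta Γ X A ν μ x = pd μ (lieOne X A ν) x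
      - ∑ γ, Γ γ μ ν x * lieOne X A γ x - lieT2 X (covOne Γ A) μ ν x := fun μ ν => rfl
  simp only [h3, mul_sub, Finset.sum_sub_distrib, h1, h2]
  ring

lemma sum_pd_Fup_mul {x : Pt4} (hgi : ∀ μ ν, ContDiff ℝ (⊤ : ℕ∞) (gi μ ν))
    (hA : ∀ μ, ContDiff ℝ (⊤ : ℕ∞) (A μ)) (hΓsym : ∀ l μ ν, Γ l μ ν x = Γ l ν μ x)
    (ω : Fin 4 → ℝ) :
    ∑ μ, ∑ β, pd μ (Fup gi A μ β) x * ω β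
      = -(4 * Real.pi) * (∑ ν, jcur gi Γ A ν x * ω ν)
        - ∑ μ, (∑ a, Γ a a μ x) * ∑ β, Fup gi A μ β x * ω β := by
  have hj : ∀ β, 4 * Real.pi * jcur gi Γ A β x
      = -∑ ν, pd ν (Fup gi A ν β) x - ∑ l, (∑ a, Γ a a l x) * Fup gi A l β x := fun β => by
    have h0 : ∑ ν, ∑ l, Γ β ν l x * Fup gi A l ν x = 0 := by
      have := sum_sum_mul_eq_zero_of_antisymm_symm (P := fun ν l => Fup gi A l ν x)
        (fun a b => Fup_antisymm gi A b a x) (hΓsym β)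
      simpa only [mul_comm] using this
    have h1 : ∀ ν, pd ν (fun y => Fup gi A β ν y) x = -pd ν (Fup gi A ν β) x := fun ν => by
      rw [show (fun y => Fup gi A β ν y) = fun y => -1 * Fup gi A ν β y from
        funext fun y => by rw [Fup_antisymm]; ring,
        pd_const_mul _ ((contDiff_Fup hgi hA ν β).differentiableAt_pt x)]
      ring
    have h2 : ∑ ν, ∑ l, Γ ν ν l x * Fup gi A β l x
        = -∑ l, (∑ a, Γ a a l x) * Fup gi A l β x := by
      rw [Finset.sum_comm, ← Finset.sum_neg_distrib]
      refine Finset.sum_congr rfl fun l _ => ?_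
      rw [← Finset.sum_mul, Fup_antisymm]
      ring
    rw [jcur, ← mul_assoc, mul_one_div_cancel (by positivity), one_mul,
      Finset.sum_add_distrib, Finset.sum_add_distrib, h0, h2]
    simp only [h1, Finset.sum_neg_distrib]
    ring
  have h4 : -(4 * Real.pi) * (∑ ν, jcur gi Γ A ν x * ω ν)
      = ∑ β, ∑ ν, pd ν (Fup gi A ν β) x * ω β
        + ∑ β, ∑ l, (∑ a, Γ a a l x) * (Fup gi A l β x * ω β) := by
    rw [Finset.mul_sum, ← Finset.sum_add_distrib]
    refine Finset.sum_congr rfl fun β _ => ?_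
    rw [← mul_assoc, neg_mul, hj]
    simp only [← mul_assoc, ← Finset.sum_mul]
    ring
  rw [h4, Finset.sum_comm, Finset.sum_comm (f := fun β l => _ * (Fup gi A l β x * ω β))]
  simp only [Finset.mul_sum]
  ring

lemma pd_noether {x : Pt4} (hv : DifferentiableAt ℝ (volg g) x)
    (hgi : ∀ μ ν, ContDiff ℝ (⊤ : ℕ∞) (gi μ ν)) (hA : ∀ μ, ContDiff ℝ (⊤ : ℕ∞) (A μ))
    (hX : ∀ μ, ContDiff ℝ (⊤ : ℕ∞) (X μ)) (c μ : Fin 4) :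
    pd c (noether g gi A X μ) x = -(1 / (4 * Real.pi)) *
      (pd c (volg g) x * ((∑ β, Fup gi A μ β x * lieOne X A β x)
          - (1 / 4) * (∑ α, ∑ β, Fup gi A α β x * FlowF A α β x) * X μ x)
        + volg g x * ((∑ β, pd c (Fup gi A μ β) x * lieOne X A β x)
          + (∑ β, Fup gi A μ β x * pd c (lieOne X A β) x)
          - (1 / 4) * (pd c (fun y => ∑ α, ∑ β, Fup gi A α β y * FlowF A α β y) x * X μ x
            + (∑ α, ∑ β, Fup gi A α β x * FlowF A α β x) * pd c (X μ) x))) := by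
  have dU := fun a b => (contDiff_Fup hgi hA a b).differentiableAt_pt x
  have dF := fun a b => (contDiff_FlowF hA a b).differentiableAt_pt x
  have dl := fun b => (contDiff_lieOne hX hA b).differentiableAt_pt x
  have dX := (hX μ).differentiableAt_pt x
  have d1 : DifferentiableAt ℝ (fun y => ∑ β, Fup gi A μ β y * lieOne X A β y) x :=
    DifferentiableAt.fun_sum fun β _ => (dU μ β).fun_mul (dl β)
  have dS : DifferentiableAt ℝ (fun y => ∑ α, ∑ β, Fup gi A α β y * FlowF A α β y) x :=
    DifferentiableAt.fun_sum fun α _ => DifferentiableAt.fun_sum fun β _ =>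
      (dU α β).fun_mul (dF α β)
  have d2 := (dS.const_mul (1 / 4)).fun_mul dX
  change pd c (fun y => -(1/(4*Real.pi)) * volg g y *
    ((∑ β, Fup gi A μ β y * lieOne X A β y)
      - (1/4) * (∑ α, ∑ β, Fup gi A α β y * FlowF A α β y) * X μ y)) x = _
  rw [pd_mul (hv.const_mul _) (d1.fun_sub d2), pd_const_mul _ hv, pd_sub d1 d2,
    pd_mul (dS.const_mul _) dX, pd_const_mul _ dS,
    pd_sum fun β _ => (dU μ β).fun_mul (dl β)]
  simp only [pd_mul (dU _ _) (dl _), Finset.sum_add_distrib]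
  ring

/-- Contracting the derivative of the inverse metric along `X` with a symmetric tensor. -/
lemma sum_mul_sum_pd_inverse_metric {x : Pt4}
    (hgisym : ∀ μ ν, gi μ ν x = gi ν μ x) (hΓsym : ∀ l μ ν, Γ l μ ν x = Γ l ν μ x)
    (hdgi : ∀ c a b, pd c (gi a b) x = -∑ d, (Γ a c d x * gi d b x + Γ b c d x * gi d a x))
    {W : Fin 4 → Fin 4 → ℝ} (hW : ∀ a b, W a b = W b a) :
    ∑ c, (∑ a, ∑ b, pd c (gi a b) x * W a b) * X c x
      = -2 * ∑ m, ∑ c, W m c * ∑ a, gi m a x * ∑ l, Γ c a l x * X l x := by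
  have hR : ∑ m, ∑ c, W m c * ∑ a, gi m a x * ∑ l, Γ c a l x * X l x
      = ∑ l, (∑ m, ∑ c, (∑ a, Γ c l a x * gi a m x) * W c m) * X l x := by
    simp only [Finset.mul_sum, Finset.sum_mul]
    refine Eq.symm <| Finset.sum_comm.trans <| Finset.sum_congr rfl fun m _ =>
      Finset.sum_comm.trans <| Finset.sum_congr rfl fun c _ =>
      Finset.sum_comm.trans <| Finset.sum_congr rfl fun a _ => Finset.sum_congr rfl fun l _ => ?_
    rw [hW c m, hgisym a m, hΓsym c l a]
    ring
  rw [hR, Finset.mul_sum]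
  refine Finset.sum_congr rfl fun c _ => ?_
  rw [← mul_assoc]
  congr 1
  simp only [hdgi, Finset.sum_add_distrib, neg_mul, add_mul, Finset.sum_neg_distrib]
  rw [Finset.sum_comm (f := fun a b => (∑ d, Γ a c d x * gi d b x) * W a b)]
  have : ∑ a, ∑ b, (∑ d, Γ b c d x * gi d a x) * W a b
      = ∑ a, ∑ b, (∑ d, Γ b c d x * gi d a x) * W b a :=
    Finset.sum_congr rfl fun a _ => Finset.sum_congr rfl fun b _ => by rw [hW a b]
  linarith

end Divergence

theorem maxwell_noether_divergence_identity
    (g gi : Fin 4 → Fin 4 → Pt4 → ℝ)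
    (Γ : Fin 4 → Fin 4 → Fin 4 → Pt4 → ℝ)
    (A X : Fin 4 → Pt4 → ℝ)
    (hg : ∀ μ ν, ContDiff ℝ (⊤ : ℕ∞) (g μ ν))
    (hgsym : ∀ μ ν x, g μ ν x = g ν μ x)
    (hdet : ∀ x, (Matrix.of fun i j : Fin 4 => g i j x).det ≠ 0)
    (hgi : ∀ μ ν, ContDiff ℝ (⊤ : ℕ∞) (gi μ ν))
    (hinv : ∀ μ ν x, (∑ σ, gi μ σ x * g σ ν x) = if μ = ν then (1:ℝ) else 0)
    -- Γ is the Levi-Civita connection of g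
    (hΓ : ∀ l μ ν x, Γ l μ ν x
      = (1/2) * ∑ σ, gi l σ x * (pd μ (g σ ν) x + pd ν (g σ μ) x - pd σ (g μ ν) x))
    (hA : ∀ μ, ContDiff ℝ (⊤ : ℕ∞) (A μ))
    (hX : ∀ μ, ContDiff ℝ (⊤ : ℕ∞) (X μ))
    (x : Pt4) :
    ∑ μ, pd μ (fun y => noether g gi A X μ y) x
      = -(volg g x/(4*Real.pi)) *
        ( -(4*Real.pi) * (∑ ν, jcur gi Γ A ν x * lieOne X A ν x)
          + (∑ μ, ∑ ν, Fup gi A μ ν x * Delta Γ X A ν μ x)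
          + ∑ μ, ∑ ν, (∑ β, Fmix gi A μ β x * FlowF A ν β x) *
              ((1/2) * ((∑ α, gi μ α x * covVec Γ X α ν x)
                        + (∑ α, gi ν α x * covVec Γ X α μ x))
                - (1/4) * gi μ ν x * (∑ α, covVec Γ X α α x)) ) := by
  have hgisym := fun y => inverse_metric_symm (fun a b => hgsym a b y) fun a b => hinv a b y
  have hΓsym := fun l μ ν y => christoffel_symm (x := y) hgsym hΓ l μ ν
  have hΓdiff : ∀ l μ ν, ContDiff ℝ (⊤ : ℕ∞) (Γ l μ ν) := fun l μ ν => by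
    rw [show Γ l μ ν = _ from funext (hΓ l μ ν)]
    exact contDiff_const.mul (ContDiff.sum fun σ _ => (hgi l σ).mul
      ((((hg σ ν).pd μ).add ((hg σ μ).pd ν)).sub ((hg μ ν).pd σ)))
  have dg := fun a b => (hg a b).differentiableAt_pt x
  have dgi := fun a b => (hgi a b).differentiableAt_pt x
  have hv := (hasFDerivAt_volg dg (hdet x) fun a b => hinv a b x).differentiableAt
  have hdv := pd_volg dg hgsym (hdet x) (fun a b => hinv a b x) hΓ
  have hdgi := pd_inverse_metric dg dgi hgsym hinv hΓ
  have hWsym := sum_Fmix_mul_FlowF_symm (A := A) (hgisym x)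
  have hmetric := sum_mul_sum_pd_inverse_metric (X := X) (hgisym x)
    (fun l μ ν => hΓsym l μ ν x) hdgi hWsym
  have hcurrent := sum_pd_Fup_mul hgi hA (fun l μ ν => hΓsym l μ ν x) fun β => lieOne X A β x
  have hsq := pd_sum_Fup_mul_FlowF hgi hA (hgisym x)
  have hdX := sum_Fup_mul_sum_FlowF (A := A) (hgisym x) fun a c => pd a (X c) x
  have hdX' := sum_Fup_mul_sum_FlowF_right (gi := gi) (A := A) x fun a c => pd a (X c) x
  have hS := sum_Fup_mul_FlowF (A := A) (hgisym x)
  rw [sum_Fup_mul_Delta hΓdiff hΓsym hA]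
  set S := ∑ a, ∑ b, Fup gi A a b x * FlowF A a b x with hSdef
  set W : Fin 4 → Fin 4 → ℝ := fun m c => ∑ b, Fmix gi A m b x * FlowF A c b x with hWdef
  set J := ∑ ν, jcur gi Γ A ν x * lieOne X A ν x
  set K := ∑ m, ∑ c, W m c * ∑ a, gi m a x * ∑ l, Γ c a l x * X l x with hK
  set D := ∑ m, ∑ c, W m c * ∑ a, gi m a x * pd a (X c) x with hD
  have hstress : ∑ μ, ∑ ν, W μ ν *
      ((1/2) * ((∑ α, gi μ α x * covVec Γ X α ν x) + (∑ α, gi ν α x * covVec Γ X α μ x))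
        - (1/4) * gi μ ν x * (∑ α, covVec Γ X α α x))
      = D + K - (1/4) * S * ∑ α, covVec Γ X α α x := by
    have h1 : ∑ μ, ∑ ν, W μ ν * ∑ α, gi μ α x * covVec Γ X α ν x = D + K := by
      simp only [hD, hK, covVec, mul_add, Finset.sum_add_distrib]
    have h2 : ∑ μ, ∑ ν, W μ ν * ∑ α, gi ν α x * covVec Γ X α μ x = D + K := by
      rw [← h1, Finset.sum_comm]
      refine Finset.sum_congr rfl fun μ _ => Finset.sum_congr rfl fun ν _ => ?_
      rw [show W ν μ = W μ ν from hWsym ν μ]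
    have h3 : ∀ w u v γ d : ℝ, w * ((1/2) * (u + v) - (1/4) * γ * d)
        = (1/2) * (w * u) + (1/2) * (w * v) - (1/4) * d * (w * γ) := fun w u v γ d => by ring
    simp only [h3, Finset.sum_add_distrib, Finset.sum_sub_distrib, ← Finset.mul_sum, h1, h2]
    rw [← hS]
    ring
  have hLie : ∑ μ, ∑ ν, Fup gi A μ ν x * lieT2 X (FlowF A) μ ν x
      = (∑ c, (∑ a, ∑ b, Fup gi A a b x * pd c (FlowF A a b) x) * X c x) + 2 * D := by
    have h1 : ∑ c, (∑ a, ∑ b, Fup gi A a b x * pd c (FlowF A a b) x) * X c x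
        = ∑ a, ∑ b, Fup gi A a b x * ∑ c, X c x * pd c (FlowF A a b) x := by
      simp only [Finset.sum_mul, Finset.mul_sum]
      rw [Finset.sum_comm]
      refine Finset.sum_congr rfl fun a _ => ?_
      rw [Finset.sum_comm]
      exact Finset.sum_congr rfl fun b _ => Finset.sum_congr rfl fun c _ => by ring
    rw [h1, ← hdX, two_mul, ← add_assoc]
    simp only [lieT2, mul_add, Finset.sum_add_distrib]
    rw [hdX']
  have hdiv : ∑ α, covVec Γ X α α x = ∑ μ, pd μ (X μ) x + ∑ μ, (∑ a, Γ a a μ x) * X μ x := by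
    simp only [covVec, Finset.sum_add_distrib, Finset.sum_mul]
    rw [Finset.sum_comm (f := fun a l => Γ a a l x * X l x)]
  have hadv : ∑ μ, pd μ (fun y => ∑ α, ∑ β, Fup gi A α β y * FlowF A α β y) x * X μ x
      = 2 * (∑ c, (∑ a, ∑ b, Fup gi A a b x * pd c (FlowF A a b) x) * X c x) - 4 * K := by
    simp only [hsq, add_mul, Finset.sum_add_distrib, mul_assoc, ← Finset.mul_sum]
    rw [hmetric]
    ring
  rw [hstress, hLie, hdiv]
  have hnoether : ∑ μ, pd μ (fun y => noether g gi A X μ y) x = -(volg g x / (4 * Real.pi)) *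
      ((∑ μ, (∑ a, Γ a a μ x) * ∑ β, Fup gi A μ β x * lieOne X A β x)
        - (1/4) * S * (∑ μ, (∑ a, Γ a a μ x) * X μ x)
        + (∑ μ, ∑ β, pd μ (Fup gi A μ β) x * lieOne X A β x)
        + (∑ μ, ∑ β, Fup gi A μ β x * pd μ (lieOne X A β) x)
        - (1/4) * (∑ μ, pd μ (fun y => ∑ α, ∑ β, Fup gi A α β y * FlowF A α β y) x * X μ x)
        - (1/4) * S * ∑ μ, pd μ (X μ) x) := by
    simp only [Finset.mul_sum (a := (1/4 : ℝ)), Finset.mul_sum (a := (1/4 : ℝ) * S),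
      ← Finset.sum_add_distrib, ← Finset.sum_sub_distrib]
    rw [Finset.mul_sum]
    refine Finset.sum_congr rfl fun μ _ => ?_
    rw [pd_noether hv hgi hA hX, hdv]
    ring
  rw [hnoether, hcurrent, hadv]
  ring
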